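/- Let S = {(1,0),(−1,0),(0,1),(0,−1)} (the simple walk, Model 1). Then both specialised interacting generating functions G_S(t;a,1) ∈ ℚ[a][[t]] and G_S(t;1,b) ∈ ℚ[b][[t]] are D-finite. -/

import Mathlib

open PowerSeries

/-- A quarter-plane loop of length `n` with steps in `S`: a sequence of points of
`ℤ≥0 × ℤ≥0` (encoded as `ℕ × ℕ`) starting and ending at the origin, with successive
differences in `S`. -/
def IsQPLoop (S : Set (ℤ × ℤ)) (n : ℕ) (w : Fin (n + 1) → ℕ × ℕ) : Prop :=
  w 0 = (0, 0) ∧ w (Fin.last n) = (0, 0) ∧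
    ∀ i : Fin n, (((w i.succ).1 : ℤ) - ((w i.castSucc).1 : ℤ),
      ((w i.succ).2 : ℤ) - ((w i.castSucc).2 : ℤ)) ∈ S

/-- The number of visits of `w` to the horizontal boundary: indices `1 ≤ i ≤ n`
with the second coordinate of `w i` equal to `0`. -/
def hvisits {n : ℕ} (w : Fin (n + 1) → ℕ × ℕ) : ℕ :=
  (Finset.univ.filter fun i : Fin (n + 1) => 0 < (i : ℕ) ∧ (w i).2 = 0).card

/-- The number of visits of `w` to the vertical boundary: indices `1 ≤ i ≤ n`
with the first coordinate of `w i` equal to `0`. -/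
def vvisits {n : ℕ} (w : Fin (n + 1) → ℕ × ℕ) : ℕ :=
  (Finset.univ.filter fun i : Fin (n + 1) => 0 < (i : ℕ) ∧ (w i).1 = 0).card

/-- The interacting generating function `G_S(t;a,b) = Σ_n t^n Σ_w a^(h(w)) b^(v(w))`,
the inner sum over all quarter-plane loops of length `n` with steps in `S`. -/
noncomputable def loopGF (S : Set (ℤ × ℤ)) {R : Type*} [CommRing R] (a b : R) :
    PowerSeries R :=
  PowerSeries.mk fun n =>
    ∑ᶠ w : {w : Fin (n + 1) → ℕ × ℕ // IsQPLoop S n w}, a ^ hvisits w.1 * b ^ vvisits w.1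

/-- A power series `F ∈ R[[t]]` is D-finite if there are polynomials `p₀, …, p_m`,
not all zero, with `Σ pᵢ · F⁽ⁱ⁾ = 0`, where `F⁽ⁱ⁾` is the `i`-th formal derivative. -/
def IsDFinite {R : Type*} [CommRing R] (F : PowerSeries R) : Prop :=
  ∃ (m : ℕ) (p : Fin (m + 1) → Polynomial R), (∃ i, p i ≠ 0) ∧
    ∑ i : Fin (m + 1), (p i : PowerSeries R) * (PowerSeries.derivativeFun)^[(i : ℕ)] F = 0

/-- Vectors in the span of fewer vectors are linearly dependent. -/
theorem exists_sum_smul_eq_zero_of_mem_span {A M ι : Type*} [CommRing A] [Nontrivial A]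
    [AddCommGroup M] [Module A M] [Fintype ι] (v : ι → M) (s : Finset M)
    (hs : s.card < Fintype.card ι) (hv : ∀ i, v i ∈ Submodule.span A (s : Set M)) :
    ∃ c : ι → A, ∑ i, c i • v i = 0 ∧ ∃ i, c i ≠ 0 := by
  rw [← Fintype.not_linearIndependent_iff]
  intro h
  have := linearIndependent_le_span_aux' v h (s : Set M) (by rintro _ ⟨i, rfl⟩; exact hv i)
  simp only [Finset.coe_sort_coe, Fintype.card_coe] at this
  omega

/-- If `Qⁿ g` lies in a step of a filtration on which `Q δ` acts with bounded degree, then so does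
`Qⁿ⁺ᵏ δᵏ g`. -/
theorem pow_mul_iterate_derivation_mem {A B : Type*} [CommRing A] [CommRing B] [Algebra A B]
    {V : ℕ → Submodule A B} {Q : B} {c : ℕ} (δ : Derivation A B B)
    (hδ : ∀ d, ∀ g ∈ V d, Q * δ g ∈ V (d + c)) (hδQ : ∀ d, ∀ g ∈ V d, δ Q * g ∈ V (d + c))
    {g : B} {n d : ℕ} (hg : Q ^ n * g ∈ V d) (k : ℕ) :
    Q ^ (n + k) * δ^[k] g ∈ V (d + c * k) := by
  induction k with
  | zero => simpa using hg
  | succ k ih =>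
    rw [Function.iterate_succ_apply', mul_add, mul_one, ← add_assoc, ← add_assoc]
    set h := δ^[k] g
    have h1 := hδ _ _ ih
    have h2 := nsmul_mem (hδQ _ _ ih) (n + k)
    have h3 := (V (d + c * k + c)).sub_mem h1 h2
    convert h3 using 1
    rw [Derivation.leibniz, Derivation.leibniz_pow]
    rcases Nat.eq_zero_or_pos (n + k) with h0 | h0
    · simp [h0]
    · obtain ⟨l, hl⟩ := Nat.exists_eq_succ_of_ne_zero h0.ne'
      simp only [hl, Nat.succ_eq_add_one, Nat.add_sub_cancel, smul_eq_mul, nsmul_eq_mul]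
      ring

/-- Holonomicity by dimension count: over a filtration of quadratic growth, the operators
`xⁱ δ₁ʲ δ₂ᵏ` applied to `f` satisfy a linear relation. -/
theorem exists_operator_relation {A B : Type*} [CommRing A] [Nontrivial A] [CommRing B] [IsDomain B]
    [Algebra A B] {V : ℕ → Submodule A B} (hV : Monotone V) (s : ℕ → Finset B)
    (hs : ∀ d, V d ≤ Submodule.span A (s d)) (hcard : ∀ d, (s d).card ≤ 4 * (d + 1) ^ 2)
    {Q x f : B} {c : ℕ} (hQ : Q ≠ 0) (δ₁ δ₂ : Derivation A B B)
    (hx : ∀ d, ∀ g ∈ V d, x * g ∈ V (d + 1)) (hQV : ∀ d, ∀ g ∈ V d, Q * g ∈ V (d + c))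
    (hδ₁ : ∀ d, ∀ g ∈ V d, Q * δ₁ g ∈ V (d + c)) (hδ₁Q : ∀ d, ∀ g ∈ V d, δ₁ Q * g ∈ V (d + c))
    (hδ₂ : ∀ d, ∀ g ∈ V d, Q * δ₂ g ∈ V (d + c)) (hδ₂Q : ∀ d, ∀ g ∈ V d, δ₂ Q * g ∈ V (d + c))
    (hf : Q * f ∈ V c) :
    ∃ (N : ℕ) (r : Fin (N + 1) × Fin (N + 1) × Fin (N + 1) → A),
      ∑ i, r i • (x ^ (i.1 : ℕ) * δ₁^[i.2.1] (δ₂^[i.2.2] f)) = 0 ∧ ∃ i, r i ≠ 0 := by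
  have hQp : ∀ n d, ∀ g ∈ V d, Q ^ n * g ∈ V (d + c * n) := by
    intro n
    induction n with
    | zero => simp
    | succ n ih =>
      intro d g hg
      rw [pow_succ', mul_assoc, mul_add, mul_one, ← add_assoc]
      exact hQV _ _ (ih d g hg)
  have hxp : ∀ n d, ∀ g ∈ V d, x ^ n * g ∈ V (d + n) := by
    intro n
    induction n with
    | zero => simp
    | succ n ih =>
      intro d g hg
      rw [pow_succ', mul_assoc, ← add_assoc]
      exact hx _ _ (ih d g hg)
  let N := 16 * (c + 1) ^ 2
  let D := (2 * c + 1) * (N + 1)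
  have key : ∀ i : Fin (N + 1) × Fin (N + 1) × Fin (N + 1),
      Q ^ (2 * N + 1) * (x ^ (i.1 : ℕ) * δ₁^[i.2.1] (δ₂^[i.2.2] f)) ∈
        Submodule.span A (s D : Set B) := by
    rintro ⟨⟨i, hi⟩, ⟨j, hj⟩, ⟨k, hk⟩⟩
    apply hs
    have h1 := pow_mul_iterate_derivation_mem (n := 1) δ₂ hδ₂ hδ₂Q (by simpa using hf) k
    have h2 := pow_mul_iterate_derivation_mem δ₁ hδ₁ hδ₁Q h1 j
    have h3 := hQp (2 * N - j - k) _ _ (hxp i _ _ h2)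
    have e : 2 * N + 1 = 2 * N - j - k + (1 + k + j) := by omega
    rw [e, pow_add, mul_assoc, mul_left_comm (Q ^ (1 + k + j))]
    refine hV ?_ h3
    have : c + c * k + c * j + i + c * (2 * N - j - k) = c * (1 + k + j + (2 * N - j - k)) + i := by
      ring
    rw [this, show 1 + k + j + (2 * N - j - k) = 2 * N + 1 by omega]
    simp only [D]
    nlinarith
  have hN : (s D).card < Fintype.card (Fin (N + 1) × Fin (N + 1) × Fin (N + 1)) := by
    simp only [Fintype.card_prod, Fintype.card_fin]
    refine (hcard D).trans_lt ?_
    have h : D + 1 ≤ (2 * c + 2) * (N + 1) := by simp only [D]; nlinarith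
    calc 4 * (D + 1) ^ 2 ≤ 4 * ((2 * c + 2) * (N + 1)) ^ 2 := by gcongr
      _ = N * (N + 1) ^ 2 := by simp only [N]; ring
      _ < (N + 1) * (N + 1) ^ 2 := by gcongr; omega
      _ = _ := by ring
  obtain ⟨r, hr, hr0⟩ := exists_sum_smul_eq_zero_of_mem_span _ (s D) hN key
  refine ⟨N, r, ?_, hr0⟩
  simp only [← mul_smul_comm _ (Q ^ (2 * N + 1)), ← Finset.mul_sum] at hr
  exact (mul_eq_zero.mp hr).resolve_left (pow_ne_zero _ hQ)

/-- The derivative of Laurent polynomials, `Tⁿ ↦ n Tⁿ⁻¹`, as a linear map. -/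
noncomputable def laurentDerivLinear (A : Type*) [CommRing A] :
    LaurentPolynomial A →ₗ[A] LaurentPolynomial A :=
  (Finsupp.lsum A fun n : ℤ => (n : A) • AddMonoidAlgebra.lsingle (n - 1)) ∘ₗ
    (AddMonoidAlgebra.coeffLinearEquiv A).toLinearMap

theorem laurentDerivLinear_single {A : Type*} [CommRing A] (n : ℤ) (r : A) :
    laurentDerivLinear A (.single n r) = .single (n - 1) (n * r) := by
  simp only [laurentDerivLinear]
  simp [-LaurentPolynomial.single_eq_C_mul_T]

theorem coeff_laurentDerivLinear {A : Type*} [CommRing A] (f : LaurentPolynomial A) (m : ℤ) :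
    (laurentDerivLinear A f).coeff m = (m + 1) * f.coeff (m + 1) := by
  induction f using LaurentPolynomial.induction_on' with
  | add p q hp hq => simp [hp, hq, mul_add]
  | C_mul_T n r =>
    rw [← LaurentPolynomial.single_eq_C_mul_T, laurentDerivLinear_single]
    simp only [AddMonoidAlgebra.coeff_single, Finsupp.single_apply]
    by_cases h : n = m + 1
    · subst h; simp
    · have h' : ¬ n - 1 = m := by omega
      simp [h, h']

/-- The derivative of Laurent polynomials as a derivation. -/
noncomputable def laurentDeriv (A : Type*) [CommRing A] :
    Derivation A (LaurentPolynomial A) (LaurentPolynomial A) :=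
  Derivation.mk' (laurentDerivLinear A) fun f g => by
    induction f using LaurentPolynomial.induction_on' with
    | add p q hp hq => simp only [add_mul, map_add, hp, hq, smul_eq_mul, mul_add]; ring
    | C_mul_T n r =>
      induction g using LaurentPolynomial.induction_on' with
      | add p q hp hq => simp only [add_mul, map_add, hp, hq, smul_eq_mul, mul_add]; ring
      | C_mul_T m s =>
        simp only [← LaurentPolynomial.single_eq_C_mul_T, laurentDerivLinear_single,
          AddMonoidAlgebra.single_mul_single, smul_eq_mul]
        rw [show n + (m - 1) = n + m - 1 by ring, show m + (n - 1) = n + m - 1 by ring,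
          ← AddMonoidAlgebra.single_add]
        congr 1
        push_cast
        ring

theorem coeff_laurentDeriv {A : Type*} [CommRing A] (f : LaurentPolynomial A) (m : ℤ) :
    (laurentDeriv A f).coeff m = (m + 1) * f.coeff (m + 1) :=
  coeff_laurentDerivLinear f m

/-- A derivation of the coefficient ring, applied to a power series coefficientwise. -/
noncomputable def coeffDeriv {A B : Type*} [CommRing A] [CommRing B] [Algebra A B]
    (δ : Derivation A B B) : Derivation A B⟦X⟧ B⟦X⟧ :=
  Derivation.mk'
    { toFun := fun f => PowerSeries.mk fun n => δ (coeff n f)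
      map_add' := fun f g => by ext n; simp
      map_smul' := fun r f => by ext n; simp }
    fun f g => by
      ext n
      simp only [LinearMap.coe_mk, AddHom.coe_mk, coeff_mk, coeff_mul, map_sum, map_add,
        Derivation.leibniz, smul_eq_mul, Finset.sum_add_distrib]
      congr 1
      exact Finset.sum_nbij' Prod.swap Prod.swap (by simp [add_comm]) (by simp [add_comm])
        (by simp) (by simp) (by simp)

@[simp]
theorem coeff_coeffDeriv {A B : Type*} [CommRing A] [CommRing B] [Algebra A B]
    (δ : Derivation A B B) (f : B⟦X⟧) (n : ℕ) : coeff n (coeffDeriv δ f) = δ (coeff n f) :=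
  coeff_mk n fun n => δ (coeff n f)

/-- The coefficient of `Tᵐ` in a power series with Laurent polynomial coefficients. -/
noncomputable def laurentCoeff {A : Type*} [CommRing A] (m : ℤ) :
    (LaurentPolynomial A)⟦X⟧ →ₗ[A] A⟦X⟧ where
  toFun f := PowerSeries.mk fun n => (coeff n f).coeff m
  map_add' f g := by ext n; simp
  map_smul' r f := by ext n; simp

@[simp]
theorem coeff_laurentCoeff {A : Type*} [CommRing A] (m : ℤ) (f : (LaurentPolynomial A)⟦X⟧) (n : ℕ) :
    coeff n (laurentCoeff m f) = (coeff n f).coeff m :=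
  coeff_mk n fun n => (coeff n f).coeff m

theorem laurentCoeff_X_pow_mul {A : Type*} [CommRing A] (m : ℤ) (i : ℕ)
    (f : (LaurentPolynomial A)⟦X⟧) :
    laurentCoeff m (X ^ i * f) = X ^ i * laurentCoeff m f := by
  ext n
  simp only [coeff_laurentCoeff, coeff_X_pow_mul']
  split_ifs <;> simp

theorem laurentCoeff_iterate_derivative {A : Type*} [CommRing A] (m : ℤ) (j : ℕ)
    (f : (LaurentPolynomial A)⟦X⟧) :
    laurentCoeff m ((derivative (LaurentPolynomial A))^[j] f) =
      (derivative A)^[j] (laurentCoeff m f) := by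
  induction j generalizing f with
  | zero => rfl
  | succ j ih =>
    rw [Function.iterate_succ_apply, Function.iterate_succ_apply, ih]
    congr 1
    ext n
    have h : ((n : LaurentPolynomial A) + 1) = algebraMap A _ ((n : A) + 1) := by simp
    rw [coeff_laurentCoeff, coeff_derivative, coeff_derivative, coeff_laurentCoeff, h, mul_comm,
      ← Algebra.smul_def]
    simp [mul_comm]

theorem laurentCoeff_iterate_coeffDeriv {A : Type*} [CommRing A] (m : ℤ) (k : ℕ)
    (f : (LaurentPolynomial A)⟦X⟧) :
    laurentCoeff m ((coeffDeriv (laurentDeriv A))^[k] f) =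
      (∏ l ∈ Finset.range k, ((m : A) + 1 + l)) • laurentCoeff (m + k) f := by
  induction k generalizing m with
  | zero => simp
  | succ k ih =>
    rw [Function.iterate_succ_apply', Finset.prod_range_succ', mul_comm, mul_smul]
    have h : laurentCoeff m (coeffDeriv (laurentDeriv A) ((coeffDeriv (laurentDeriv A))^[k] f)) =
        ((m : A) + 1) • laurentCoeff (m + 1) ((coeffDeriv (laurentDeriv A))^[k] f) := by
      ext n
      simp [coeff_laurentDeriv]
    rw [h, ih, add_assoc m, add_comm (1 : ℤ)]
    push_cast
    rw [add_zero]
    simp only [add_comm, add_left_comm]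

/-- A linear relation between the operators `Xⁱ ∂_Xʲ ∂_Tᵏ` applied to `f` yields a differential
equation for the residue of `f` in `T`. -/
theorem isDFinite_laurentCoeff_of_relation {A : Type*} [CommRing A] [IsDomain A] [CharZero A]
    (f : (LaurentPolynomial A)⟦X⟧) (N : ℕ)
    (r : Fin (N + 1) × Fin (N + 1) × Fin (N + 1) → A)
    (hr : ∑ i, r i • (X ^ (i.1 : ℕ) * (derivative (LaurentPolynomial A))^[i.2.1]
      ((coeffDeriv (laurentDeriv A))^[i.2.2] f)) = 0) (hr0 : ∃ i, r i ≠ 0) :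
    IsDFinite (laurentCoeff (-1) f) := by
  classical
  obtain ⟨k, ⟨i₀, j₀, hk⟩, hmin⟩ : ∃ k : Fin (N + 1), (∃ i j, r (i, j, k) ≠ 0) ∧
      ∀ l < k, ¬ ∃ i j, r (i, j, l) ≠ 0 := by
    obtain ⟨⟨i, j, k⟩, h⟩ := hr0
    have hne : ∃ k : Fin (N + 1), ∃ i j, r (i, j, k) ≠ 0 := ⟨k, i, j, h⟩
    obtain ⟨k, hk, hmin⟩ := WellFounded.has_min (wellFounded_lt (α := Fin (N + 1)))
      {k | ∃ i j, r (i, j, k) ≠ 0} hne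
    exact ⟨k, hk, fun l hl hl' => hmin l hl' hl⟩
  refine ⟨N, fun j => ∑ i : Fin (N + 1), Polynomial.monomial (i : ℕ) (r (i, j, k)), ⟨j₀, ?_⟩, ?_⟩
  · intro h
    apply hk
    have h' := congrArg (fun p => Polynomial.coeff p (i₀ : ℕ)) h
    simpa [Polynomial.finsetSum_coeff, Polynomial.coeff_monomial, Fin.val_inj] using h'
  · set G := laurentCoeff (-1) f
    let P : ℕ → A := fun n => ∏ l ∈ Finset.range n, (((-1 - k : ℤ) : A) + 1 + l)
    have hP : P k ≠ 0 := by
      rw [Finset.prod_ne_zero_iff]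
      intro l hl
      have : ((-1 - k : ℤ) : A) + 1 + l = ((l - k : ℤ) : A) := by push_cast; ring
      rw [this, Int.cast_ne_zero]
      have := Finset.mem_range.mp hl
      omega
    have hP' : ∀ n : ℕ, (k : ℕ) < n → P n = 0 := by
      intro n hn
      apply Finset.prod_eq_zero (Finset.mem_range.mpr hn)
      push_cast
      ring
    have hder : ∀ g : A⟦X⟧, ∀ j, PowerSeries.derivativeFun^[j] g = (derivative A)^[j] g :=
      fun g j => rfl
    have h := congrArg (laurentCoeff (-1 - k : ℤ)) hr
    simp only [map_sum, map_smul, map_zero, laurentCoeff_X_pow_mul,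
      laurentCoeff_iterate_derivative, laurentCoeff_iterate_coeffDeriv] at h
    have hit : ∀ (j : ℕ) (c : A) (g : A⟦X⟧),
        (derivative A)^[j] (c • g) = c • (derivative A)^[j] g := by
      intro j c g
      induction j with
      | zero => rfl
      | succ j ih =>
        rw [Function.iterate_succ_apply', ih, Derivation.map_smul, Function.iterate_succ_apply']
    have hterm : ∀ i j l : Fin (N + 1),
        r (i, j, l) • (X ^ (i : ℕ) * (derivative A)^[j] (P l • laurentCoeff (-1 - k + l : ℤ) f)) =
          if l = k then P k • (r (i, j, k) • (X ^ (i : ℕ) * (derivative A)^[j] G)) else 0 := by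
      intro i j l
      rw [hit]
      rcases lt_trichotomy l k with hl | hl | hl
      · have h0 : r (i, j, l) = 0 := by
          by_contra h0
          exact hmin l hl ⟨i, j, h0⟩
        simp [h0, hl.ne]
      · subst hl
        rw [if_pos rfl, mul_smul_comm, smul_comm, sub_add_cancel]
      · simp [hP' l hl, hl.ne']
    simp only [Fintype.sum_prod_type] at h
    change ∑ i : Fin (N + 1), ∑ j : Fin (N + 1), ∑ l : Fin (N + 1),
        r (i, j, l) • (X ^ (i : ℕ) * (derivative A)^[j] (P l • laurentCoeff (-1 - k + l : ℤ) f)) =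
      0 at h
    simp only [hterm, Finset.sum_ite_eq', Finset.mem_univ, if_true, ← Finset.smul_sum] at h
    rw [Finset.sum_comm] at h
    rw [PowerSeries.smul_eq_C_mul] at h
    have h := (mul_eq_zero.mp h).resolve_left
      ((map_ne_zero_iff _ PowerSeries.C_injective).mpr hP)
    rw [← h]
    refine Finset.sum_congr rfl fun j _ => ?_
    rw [hder, ← Polynomial.coeToPowerSeries.ringHom_apply, map_sum, Finset.sum_mul]
    refine Finset.sum_congr rfl fun i _ => ?_
    rw [Polynomial.coeToPowerSeries.ringHom_apply, Polynomial.coe_monomial,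
      PowerSeries.monomial_eq_C_mul_X_pow, PowerSeries.smul_eq_C_mul, mul_assoc]

/-- The monomials `Xⁱ Tᵐ` with `i ≤ d` and `|m| ≤ d`. -/
noncomputable def laurentMonomials (A : Type*) [CommRing A] (d : ℕ) :
    Finset (LaurentPolynomial A)⟦X⟧ :=
  open Classical in (Finset.range (d + 1) ×ˢ Finset.Icc (-d : ℤ) d).image
    fun i => PowerSeries.monomial i.1 (LaurentPolynomial.T i.2)

/-- The span of the monomials `Xⁱ Tᵐ` with `i ≤ d` and `|m| ≤ d`. -/
noncomputable def boundedDegree (A : Type*) [CommRing A] (d : ℕ) :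
    Submodule A (LaurentPolynomial A)⟦X⟧ :=
  Submodule.span A (laurentMonomials A d)

section boundedDegree

variable {A : Type*} [CommRing A]

theorem card_laurentMonomials_le (d : ℕ) : (laurentMonomials A d).card ≤ 2 * (d + 1) ^ 2 := by
  classical
  refine Finset.card_image_le.trans ?_
  rw [Finset.card_product, Finset.card_range, Int.card_Icc,
    show ((d : ℤ) + 1 - -d).toNat = 2 * d + 1 by omega]
  nlinarith

theorem mem_laurentMonomials {d : ℕ} {f : (LaurentPolynomial A)⟦X⟧} :
    f ∈ laurentMonomials A d ↔ ∃ (i : ℕ) (m : ℤ), i ≤ d ∧ -d ≤ m ∧ m ≤ d ∧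
      PowerSeries.monomial i (LaurentPolynomial.T m) = f := by
  simp [laurentMonomials, Prod.exists, and_assoc]

theorem monomial_T_mem_boundedDegree {d i : ℕ} {m : ℤ} (hi : i ≤ d) (hm : -d ≤ m) (hm' : m ≤ d) :
    PowerSeries.monomial i (LaurentPolynomial.T m) ∈ boundedDegree A d :=
  Submodule.subset_span (mem_laurentMonomials.mpr ⟨i, m, hi, hm, hm', rfl⟩)

theorem boundedDegree_mono : Monotone (boundedDegree A) := by
  intro d e h
  refine Submodule.span_le.mpr fun f hf => ?_
  obtain ⟨i, m, hi, hm, hm', rfl⟩ := mem_laurentMonomials.mp hf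
  exact monomial_T_mem_boundedDegree (by omega) (by omega) (by omega)

theorem mul_mem_boundedDegree {d e : ℕ} {f g : (LaurentPolynomial A)⟦X⟧}
    (hf : f ∈ boundedDegree A d) (hg : g ∈ boundedDegree A e) : f * g ∈ boundedDegree A (d + e) := by
  have h := Submodule.mul_mem_mul hf hg
  rw [boundedDegree, boundedDegree, Submodule.span_mul_span] at h
  refine Submodule.span_le.mpr ?_ h
  rintro _ ⟨f, hf, g, hg, rfl⟩
  obtain ⟨i, m, hi, hm, hm', rfl⟩ := mem_laurentMonomials.mp hf
  obtain ⟨j, n, hj, hn, hn', rfl⟩ := mem_laurentMonomials.mp hg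
  simp only [PowerSeries.monomial_mul_monomial, ← LaurentPolynomial.T_add]
  exact monomial_T_mem_boundedDegree (by omega) (by push_cast; omega) (by push_cast; omega)

theorem derivative_mem_boundedDegree {d : ℕ} {f : (LaurentPolynomial A)⟦X⟧}
    (hf : f ∈ boundedDegree A d) :
    derivative (LaurentPolynomial A) f ∈ boundedDegree A (d + 1) := by
  have : boundedDegree A d ≤ (boundedDegree A (d + 1)).comap
      ((derivative (LaurentPolynomial A)).restrictScalars A : _ →ₗ[A] _) := by
    refine Submodule.span_le.mpr fun f hf => ?_
    obtain ⟨i, m, hi, hm, hm', rfl⟩ := mem_laurentMonomials.mp hf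
    have h : derivative (LaurentPolynomial A) (PowerSeries.monomial i (LaurentPolynomial.T m)) =
        i • PowerSeries.monomial (i - 1) (LaurentPolynomial.T m) := by
      ext1 n
      rw [coeff_derivative, map_nsmul, coeff_monomial, coeff_monomial]
      rcases i with _ | i
      · simp
      · rw [nsmul_eq_mul]
        by_cases h : n = i
        · subst h
          simp [-LaurentPolynomial.T_mul, mul_comm]
        · simp [h]
    change derivative (LaurentPolynomial A) (PowerSeries.monomial i _) ∈ boundedDegree A (d + 1)
    rw [h]
    exact nsmul_mem (monomial_T_mem_boundedDegree (by omega) (by omega) (by omega)) _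
  exact this hf

theorem coeffDeriv_mem_boundedDegree {d : ℕ} {f : (LaurentPolynomial A)⟦X⟧}
    (hf : f ∈ boundedDegree A d) :
    coeffDeriv (laurentDeriv A) f ∈ boundedDegree A (d + 1) := by
  have : boundedDegree A d ≤ (boundedDegree A (d + 1)).comap
      (coeffDeriv (laurentDeriv A) : _ →ₗ[A] _) := by
    refine Submodule.span_le.mpr fun f hf => ?_
    obtain ⟨i, m, hi, hm, hm', rfl⟩ := mem_laurentMonomials.mp hf
    have h : coeffDeriv (laurentDeriv A) (PowerSeries.monomial i (LaurentPolynomial.T m)) =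
        m • PowerSeries.monomial i (LaurentPolynomial.T (m - 1)) := by
      have hT : laurentDeriv A (LaurentPolynomial.T m) = m • LaurentPolynomial.T (m - 1) := by
        ext n
        rw [coeff_laurentDeriv]
        simp only [LaurentPolynomial.T_apply, AddMonoidAlgebra.coeff_smul, Finsupp.smul_apply]
        by_cases h : m = n + 1
        · subst h; simp
        · simp [h, show ¬ m - 1 = n by omega]
      ext1 n
      rw [coeff_coeffDeriv, map_zsmul, coeff_monomial, coeff_monomial]
      split_ifs
      · exact hT
      · simp
    change coeffDeriv (laurentDeriv A) (PowerSeries.monomial i _) ∈ boundedDegree A (d + 1)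
    rw [h]
    exact zsmul_mem (monomial_T_mem_boundedDegree (by omega) (by push_cast; omega)
      (by push_cast; omega)) _
  exact this hf

theorem exists_mem_boundedDegree {f : (LaurentPolynomial A)⟦X⟧}
    (hf : f ∈ Algebra.adjoin A ({X, PowerSeries.C (LaurentPolynomial.T 1),
      PowerSeries.C (LaurentPolynomial.T (-1))} : Set (LaurentPolynomial A)⟦X⟧)) :
    ∃ d, f ∈ boundedDegree A d := by
  induction hf using Algebra.adjoin_induction with
  | mem f hf =>
    rcases hf with rfl | rfl | rfl
    · exact ⟨1, monomial_T_mem_boundedDegree (m := 0) le_rfl (by norm_num) (by norm_num)⟩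
    · rw [← PowerSeries.monomial_zero_eq_C]
      exact ⟨1, monomial_T_mem_boundedDegree (m := 1) zero_le_one (by norm_num) (by norm_num)⟩
    · rw [← PowerSeries.monomial_zero_eq_C]
      exact ⟨1, monomial_T_mem_boundedDegree (m := -1) zero_le_one (by norm_num) (by norm_num)⟩
  | algebraMap r =>
    refine ⟨0, ?_⟩
    have h : (1 : (LaurentPolynomial A)⟦X⟧) ∈ boundedDegree A 0 := by
      rw [← map_one PowerSeries.C, ← LaurentPolynomial.T_zero, ← PowerSeries.monomial_zero_eq_C]
      exact monomial_T_mem_boundedDegree le_rfl (by norm_num) (by norm_num)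
    rw [Algebra.algebraMap_eq_smul_one]
    exact Submodule.smul_mem _ _ h
  | add f g _ _ hf hg =>
    obtain ⟨d, hd⟩ := hf
    obtain ⟨e, he⟩ := hg
    exact ⟨max d e, add_mem (boundedDegree_mono (le_max_left d e) hd)
      (boundedDegree_mono (le_max_right d e) he)⟩
  | mul f g _ _ hf hg =>
    obtain ⟨d, hd⟩ := hf
    obtain ⟨e, he⟩ := hg
    exact ⟨d + e, mul_mem_boundedDegree hd he⟩

end boundedDegree

/-- If `F` is a root of a quadratic polynomial with nonzero discriminant whose coefficients are
polynomials in `X`, `T` and `T⁻¹`, then the residue in `T` of `g F` is D-finite for any such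
polynomial `g`. -/
theorem isDFinite_laurentCoeff_of_quadratic {A : Type*} [CommRing A] [IsDomain A] [CharZero A]
    {p q r g F : (LaurentPolynomial A)⟦X⟧} {P : Subalgebra A (LaurentPolynomial A)⟦X⟧}
    (hP : P = Algebra.adjoin A {X, PowerSeries.C (LaurentPolynomial.T 1),
      PowerSeries.C (LaurentPolynomial.T (-1))})
    (hp : p ∈ P) (hq : q ∈ P) (hr : r ∈ P) (hg : g ∈ P) (hp0 : p ≠ 0)
    (hdisc : q ^ 2 - 4 * p * r ≠ 0) (hF : p * F ^ 2 + q * F + r = 0) :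
    IsDFinite (laurentCoeff (-1) (g * F)) := by
  classical
  subst hP
  obtain ⟨d, hD⟩ := exists_mem_boundedDegree
    (sub_mem (pow_mem hq 2) (mul_mem (mul_mem (ofNat_mem _ 4) hp) hr))
  obtain ⟨dp, hp⟩ := exists_mem_boundedDegree hp
  obtain ⟨dq, hq⟩ := exists_mem_boundedDegree hq
  obtain ⟨dg, hg⟩ := exists_mem_boundedDegree hg
  set D := q ^ 2 - 4 * p * r
  set E := 2 * p * F + q
  have hE : E ^ 2 = D := by simp only [E, D]; linear_combination 4 * p * hF
  let U := boundedDegree A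
  let e := d + dp + dq + dg
  have hDe : D ∈ U e := boundedDegree_mono (by omega) hD
  have hpe : p ∈ U e := boundedDegree_mono (by omega) hp
  have hQ : 2 * D * p ∈ U (2 * e) := by
    have h := nsmul_mem (mul_mem_boundedDegree hDe hpe) 2
    rw [nsmul_eq_mul, ← two_mul e] at h
    convert h using 1
    push_cast
    ring
  let V : ℕ → Submodule A (LaurentPolynomial A)⟦X⟧ := fun n =>
    U n ⊔ (U n).map (LinearMap.mulRight A E)
  have hV : ∀ {n f}, f ∈ V n ↔ ∃ u ∈ U n, ∃ v ∈ U n, f = u + v * E := by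
    intro n f
    simp only [V, Submodule.mem_sup, Submodule.mem_map, LinearMap.mulRight_apply,
      exists_exists_and_eq_and, eq_comm (b := f)]
  have hVmono : Monotone V := fun m n h =>
    sup_le_sup (boundedDegree_mono h) (Submodule.map_mono (boundedDegree_mono h))
  have hUV : ∀ m n u f, u ∈ U m → f ∈ V n → u * f ∈ V (n + m) := by
    intro m n u f hu hf
    obtain ⟨v, hv, w, hw, rfl⟩ := hV.mp hf
    rw [add_comm n m]
    exact hV.mpr ⟨u * v, mul_mem_boundedDegree hu hv, u * w, mul_mem_boundedDegree hu hw, by ring⟩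
  have hδ : ∀ δ : Derivation A (LaurentPolynomial A)⟦X⟧ (LaurentPolynomial A)⟦X⟧,
      (∀ n, ∀ u ∈ U n, δ u ∈ U (n + 1)) → ∀ n, ∀ f ∈ V n, 2 * D * p * δ f ∈ V (n + (2 * e + 1)) := by
    intro δ hδU n f hf
    obtain ⟨u, hu, v, hv, rfl⟩ := hV.mp hf
    have hδE : 2 * D * δ E = E * δ D := by
      rw [← hE, Derivation.leibniz_pow]
      simp only [smul_eq_mul, nsmul_eq_mul]
      push_cast
      ring
    refine hV.mpr ⟨2 * D * p * δ u, ?_, 2 * D * p * δ v + v * (p * δ D), ?_, ?_⟩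
    · have h := mul_mem_boundedDegree hQ (hδU _ _ hu)
      rwa [show 2 * e + (n + 1) = n + (2 * e + 1) by ring] at h
    · have h := mul_mem_boundedDegree hQ (hδU _ _ hv)
      have h' := mul_mem_boundedDegree hv (mul_mem_boundedDegree hpe (hδU _ _ hDe))
      rw [show 2 * e + (n + 1) = n + (2 * e + 1) by ring] at h
      rw [show n + (e + (e + 1)) = n + (2 * e + 1) by ring] at h'
      exact add_mem h h'
    · rw [map_add, Derivation.leibniz]
      simp only [smul_eq_mul]
      linear_combination v * p * hδE
  have h1 : ∀ n, ∀ u ∈ U n, ((derivative (LaurentPolynomial A)).restrictScalars A :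
      Derivation A (LaurentPolynomial A)⟦X⟧ (LaurentPolynomial A)⟦X⟧) u ∈ U (n + 1) :=
    fun n u hu => derivative_mem_boundedDegree hu
  have h2 : ∀ n, ∀ u ∈ U n, coeffDeriv (laurentDeriv A) u ∈ U (n + 1) :=
    fun n u hu => coeffDeriv_mem_boundedDegree hu
  have hX : (X : (LaurentPolynomial A)⟦X⟧) ∈ U 1 :=
    monomial_T_mem_boundedDegree (m := 0) le_rfl (by norm_num) (by norm_num)
  have hQ0 : 2 * D * p ≠ 0 := by
    have : (2 : (LaurentPolynomial A)⟦X⟧) ≠ 0 := by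
      rw [← map_ofNat (algebraMap A (LaurentPolynomial A)⟦X⟧) 2]
      intro h
      have h' := congrArg (fun f => (coeff 0 f).coeff 0) h
      simp [PowerSeries.algebraMap_apply] at h'
    exact mul_ne_zero (mul_ne_zero this hdisc) hp0
  have hf : 2 * D * p * (g * F) ∈ V (2 * e + 1) := by
    have h : g * D ∈ U (d + dg) := by
      rw [add_comm]
      exact mul_mem_boundedDegree hg hD
    refine hVmono (by omega : d + dg + dq ≤ 2 * e + 1) (hV.mpr ⟨-(g * D * q),
      neg_mem (mul_mem_boundedDegree h hq), g * D, boundedDegree_mono (by omega) h, ?_⟩)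
    simp only [E]
    ring
  let S : ℕ → Finset (LaurentPolynomial A)⟦X⟧ := fun n =>
    laurentMonomials A n ∪ (laurentMonomials A n).image (· * E)
  have hspan : ∀ n, V n ≤ Submodule.span A (S n) := by
    intro n
    simp only [S]
    rw [Finset.coe_union, Submodule.span_union, Finset.coe_image]
    refine sup_le_sup le_rfl ?_
    simp only [U, boundedDegree, Submodule.map_span]
    exact le_rfl
  have hcard : ∀ n, (S n).card ≤ 4 * (n + 1) ^ 2 := by
    intro n
    refine (Finset.card_union_le _ _).trans ?_
    have h1 := card_laurentMonomials_le (A := A) n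
    have h2 := Finset.card_image_le (s := laurentMonomials A n) (f := (· * E))
    omega
  obtain ⟨N, c, hc, hc0⟩ := exists_operator_relation hVmono S hspan hcard (f := g * F) hQ0 _ _
    (fun n f hf => hUV 1 n X f hX hf) (fun n f hf => hVmono (by omega) (hUV _ n _ f hQ hf))
    (hδ _ h1) (fun n f hf => hUV _ n _ f (h1 _ _ hQ) hf) (hδ _ h2)
    (fun n f hf => hUV _ n _ f (h2 _ _ hQ) hf) hf
  exact isDFinite_laurentCoeff_of_relation _ N c hc hc0

/-- The lattice neighbours of a point inside the quarter plane. -/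
def quarterNeighbours : ℕ × ℕ → Finset (ℕ × ℕ)
  | (0, 0) => {(1, 0), (0, 1)}
  | (i + 1, 0) => {(i + 2, 0), (i + 1, 1), (i, 0)}
  | (0, j + 1) => {(1, j + 1), (0, j + 2), (0, j)}
  | (i + 1, j + 1) => {(i + 2, j + 1), (i + 1, j + 2), (i, j + 1), (i + 1, j)}

theorem mem_quarterNeighbours {p q : ℕ × ℕ} :
    p ∈ quarterNeighbours q ↔ ((q.1 : ℤ) - (p.1 : ℤ), (q.2 : ℤ) - (p.2 : ℤ)) ∈
      ({((1:ℤ), (0:ℤ)), (-1, 0), (0, 1), (0, -1)} : Set (ℤ × ℤ)) := by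
  obtain ⟨k, l⟩ := p
  rcases q with ⟨_ | i, _ | j⟩ <;>
    simp only [quarterNeighbours, Finset.mem_insert, Finset.mem_singleton, Prod.mk.injEq,
      Set.mem_insert_iff, Set.mem_singleton_iff] <;> omega

theorem sum_quarterNeighbours {M : Type*} [AddCommMonoid M] (f : ℕ × ℕ → M) (i j : ℕ) :
    ∑ p ∈ quarterNeighbours (i, j), f p = f (i + 1, j) + f (i, j + 1) +
      (if i = 0 then 0 else f (i - 1, j)) + (if j = 0 then 0 else f (i, j - 1)) := by
  rcases i with _ | i <;> rcases j with _ | j <;> simp [quarterNeighbours, add_assoc]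

/-- The simple walks of length `n` in the quarter plane from the origin to `q`. -/
def simpleWalks : (n : ℕ) → ℕ × ℕ → Finset (Fin (n + 1) → ℕ × ℕ)
  | 0, q => if q = (0, 0) then {fun _ => (0, 0)} else ∅
  | n + 1, q => (quarterNeighbours q).biUnion fun p =>
      (simpleWalks n p).image fun w => (Fin.snoc w q : Fin (n + 2) → ℕ × ℕ)

theorem mem_simpleWalks {n : ℕ} {q : ℕ × ℕ} {w : Fin (n + 1) → ℕ × ℕ} :
    w ∈ simpleWalks n q ↔ w 0 = (0, 0) ∧ w (Fin.last n) = q ∧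
      ∀ i : Fin n, w i.castSucc ∈ quarterNeighbours (w i.succ) := by
  induction n generalizing q with
  | zero =>
    simp only [simpleWalks, IsEmpty.forall_iff, and_true]
    split_ifs with h
    · subst h
      simp only [Finset.mem_singleton]
      refine ⟨fun h => by simp [h], fun h => ?_⟩
      ext1 i
      obtain rfl : i = 0 := Fin.fin_one_eq_zero i
      exact h.1
    · simp only [Finset.notMem_empty, false_iff, not_and]
      intro h0 h1
      exact h (h1.symm.trans h0)
  | succ n ih =>
    simp only [simpleWalks, Finset.mem_biUnion, Finset.mem_image]
    constructor
    · rintro ⟨p, hp, v, hv, rfl⟩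
      obtain ⟨h0, h1, h2⟩ := ih.mp hv
      refine ⟨?_, Fin.snoc_last _ _, ?_⟩
      · rw [← Fin.castSucc_zero, Fin.snoc_castSucc, h0]
      · refine Fin.lastCases ?_ fun i => ?_
        · rw [Fin.snoc_castSucc, Fin.succ_last, Fin.snoc_last, h1]
          exact hp
        · rw [Fin.snoc_castSucc, Fin.succ_castSucc, Fin.snoc_castSucc]
          exact h2 i
    · rintro ⟨h0, h1, h2⟩
      refine ⟨w (Fin.last n).castSucc, ?_, Fin.init w, ih.mpr ⟨h0, rfl, fun i => ?_⟩, ?_⟩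
      · have := h2 (Fin.last n)
        rwa [Fin.succ_last, h1] at this
      · exact h2 i.castSucc
      · rw [← h1, Fin.snoc_init_self]

theorem hvisits_snoc {n : ℕ} (w : Fin (n + 1) → ℕ × ℕ) (q : ℕ × ℕ) :
    hvisits (Fin.snoc w q : Fin (n + 2) → ℕ × ℕ) = hvisits w + if q.2 = 0 then 1 else 0 := by
  simp only [hvisits, Finset.card_filter]
  rw [Fin.sum_univ_castSucc]
  simp

theorem vvisits_snoc {n : ℕ} (w : Fin (n + 1) → ℕ × ℕ) (q : ℕ × ℕ) :
    vvisits (Fin.snoc w q : Fin (n + 2) → ℕ × ℕ) = vvisits w + if q.1 = 0 then 1 else 0 := by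
  simp only [vvisits, Finset.card_filter]
  rw [Fin.sum_univ_castSucc]
  simp

/-- The total weight of the simple walks of length `n` from the origin to `(i, j)`. -/
def simpleWalkWeight {A : Type*} [CommRing A] (a b : A) : ℕ → ℕ → ℕ → A
  | 0, i, j => if i = 0 ∧ j = 0 then 1 else 0
  | n + 1, i, j => (if j = 0 then a else 1) * (if i = 0 then b else 1) *
      (simpleWalkWeight a b n (i + 1) j + simpleWalkWeight a b n i (j + 1) +
        (if i = 0 then 0 else simpleWalkWeight a b n (i - 1) j) +
        (if j = 0 then 0 else simpleWalkWeight a b n i (j - 1)))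

theorem simpleWalkWeight_comm {A : Type*} [CommRing A] (a b : A) (n i j : ℕ) :
    simpleWalkWeight a b n i j = simpleWalkWeight b a n j i := by
  induction n generalizing i j with
  | zero => simp only [simpleWalkWeight, and_comm]
  | succ n ih =>
    simp only [simpleWalkWeight, ih]
    ring

theorem sum_simpleWalks {A : Type*} [CommRing A] (a b : A) (n i j : ℕ) :
    ∑ w ∈ simpleWalks n (i, j), a ^ hvisits w * b ^ vvisits w = simpleWalkWeight a b n i j := by
  induction n generalizing i j with
  | zero =>
    simp only [simpleWalks, simpleWalkWeight, Prod.mk.injEq]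
    split_ifs <;> simp [hvisits, vvisits]
  | succ n ih =>
    have hinj : Function.Injective fun w : Fin (n + 1) → ℕ × ℕ =>
        (Fin.snoc w (i, j) : Fin (n + 2) → ℕ × ℕ) := 
      Fin.snoc_left_injective (α := fun _ => ℕ × ℕ) (i, j)
    rw [simpleWalks, Finset.sum_biUnion, simpleWalkWeight, ← ih, ← ih, ← ih, ← ih,
      ← sum_quarterNeighbours fun p => ∑ w ∈ simpleWalks n p, a ^ hvisits w * b ^ vvisits w,
      Finset.mul_sum]
    · refine Finset.sum_congr rfl fun p _ => ?_
      rw [Finset.sum_image fun _ _ _ _ h => hinj h, Finset.mul_sum]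
      refine Finset.sum_congr rfl fun w _ => ?_
      rw [hvisits_snoc, vvisits_snoc]
      split_ifs <;> ring
    · intro p _ p' _ hpp'
      simp only [Function.onFun, Finset.disjoint_left, Finset.mem_image, not_exists, not_and]
      rintro _ ⟨w, hw, rfl⟩ w' hw' h
      obtain rfl := hinj h
      exact hpp' ((mem_simpleWalks.mp hw).2.1.symm.trans (mem_simpleWalks.mp hw').2.1)

theorem coeff_loopGF_simple {A : Type*} [CommRing A] (a b : A) (n : ℕ) :
    coeff n (loopGF ({((1:ℤ), (0:ℤ)), (-1, 0), (0, 1), (0, -1)} : Set (ℤ × ℤ)) a b) =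
      simpleWalkWeight a b n 0 0 := by
  have h : ∀ w : Fin (n + 1) → ℕ × ℕ,
      IsQPLoop {((1:ℤ), (0:ℤ)), (-1, 0), (0, 1), (0, -1)} n w ↔ w ∈ simpleWalks n (0, 0) := by
    intro w
    simp only [mem_simpleWalks, mem_quarterNeighbours, IsQPLoop]
  rw [loopGF, coeff_mk, ← sum_simpleWalks, ← finsum_mem_coe_finset]
  refine (finsum_subtype_eq_finsum_cond (f := fun w : Fin (n + 1) → ℕ × ℕ =>
    a ^ hvisits w * b ^ vvisits w) _).trans ?_
  simp only [h, Finset.mem_coe]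

/-- The number of excursions of length `n - 1`, horizontal steps having weight `u`. -/
noncomputable def excursionCoeff {B : Type*} [CommRing B] (u : B) : ℕ → B
  | 0 => 0
  | n + 1 => (if n = 0 then 1 else 0) + u * excursionCoeff u n +
      ∑ i : Fin (n + 1), excursionCoeff u i * excursionCoeff u (n - i)

theorem exists_excursionSeries {B : Type*} [CommRing B] (u : B) :
    ∃ c : B⟦X⟧, constantCoeff c = 0 ∧ c = X * (1 + PowerSeries.C u * c + c ^ 2) := by
  refine ⟨PowerSeries.mk (excursionCoeff u), ?_, ?_⟩
  · simp [← coeff_zero_eq_constantCoeff_apply, excursionCoeff]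
  · ext n
    rcases n with _ | n
    · simp [excursionCoeff]
    · rw [coeff_succ_X_mul, coeff_mk, excursionCoeff, map_add, map_add, coeff_one, coeff_C_mul,
        coeff_mk, sq, coeff_mul, Finset.Nat.sum_antidiagonal_eq_sum_range_succ_mk, Finset.sum_range]
      simp

/-- The generating Laurent polynomial, by abscissa, of the simple walks of length `n` in the upper
half plane from the origin to height `j`, with weight `a` for each visit to the horizontal axis. -/
noncomputable def halfPlaneWeight {A : Type*} [CommRing A] (a : A) :
    ℕ → ℕ → LaurentPolynomial A
  | 0, j => if j = 0 then 1 else 0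
  | n + 1, j => LaurentPolynomial.C (if j = 0 then a else 1) *
      ((LaurentPolynomial.T 1 + LaurentPolynomial.T (-1)) * halfPlaneWeight a n j +
        halfPlaneWeight a n (j + 1) + if j = 0 then 0 else halfPlaneWeight a n (j - 1))

theorem coeff_T_mul {A : Type*} [CommRing A] (k m : ℤ) (f : LaurentPolynomial A) :
    (LaurentPolynomial.T k * f).coeff m = f.coeff (m - k) := by
  induction f using LaurentPolynomial.induction_on' with
  | add p q hp hq => simp only [mul_add, AddMonoidAlgebra.coeff_add, Finsupp.add_apply, hp, hq]
  | C_mul_T n r =>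
    rw [mul_left_comm, ← LaurentPolynomial.T_add, ← LaurentPolynomial.single_eq_C_mul_T,
      ← LaurentPolynomial.single_eq_C_mul_T]
    simp only [AddMonoidAlgebra.coeff_single, Finsupp.single_apply]
    congr 1
    exact propext (by omega)

theorem coeff_C_mul_laurent {A : Type*} [CommRing A] (r : A) (m : ℤ) (f : LaurentPolynomial A) :
    (LaurentPolynomial.C r * f).coeff m = r * f.coeff m := by
  rw [← LaurentPolynomial.smul_eq_C_mul]
  rfl

/-- The reflection principle across the line of abscissa `-1`. -/
theorem simpleWalkWeight_eq_coeff_halfPlaneWeight {A : Type*} [CommRing A] (a : A) (n i j : ℕ) :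
    simpleWalkWeight a 1 n i j =
      (halfPlaneWeight a n j).coeff i - (halfPlaneWeight a n j).coeff (-2 - i) := by
  induction n generalizing i j with
  | zero =>
    have h : ∀ m : ℤ, (1 : LaurentPolynomial A).coeff m = if m = 0 then 1 else 0 := by
      intro m
      rw [← map_one LaurentPolynomial.C, LaurentPolynomial.C_apply]
    by_cases hj : j = 0
    · simp [simpleWalkWeight, halfPlaneWeight, hj, h, show ¬ (-2 - (i : ℤ) = 0) by omega]
    · simp [simpleWalkWeight, halfPlaneWeight, hj]
  | succ n ih =>
    have hprev : (if i = 0 then 0 else simpleWalkWeight a 1 n (i - 1) j) =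
        (halfPlaneWeight a n j).coeff ((i : ℤ) - 1) -
          (halfPlaneWeight a n j).coeff (-2 - i + 1) := by
      rcases i with _ | i
      · simp
      · rw [if_neg (Nat.succ_ne_zero i), ih]
        congr 2 <;> push_cast <;> ring_nf
    have hnext : simpleWalkWeight a 1 n (i + 1) j =
        (halfPlaneWeight a n j).coeff ((i : ℤ) + 1) -
          (halfPlaneWeight a n j).coeff (-2 - i - 1) := by
      rw [ih]
      congr 2
      push_cast
      ring
    rw [simpleWalkWeight, hprev, hnext, ih, ih]
    simp only [halfPlaneWeight, coeff_C_mul_laurent, AddMonoidAlgebra.coeff_add, Finsupp.add_apply,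
      add_mul, coeff_T_mul, sub_neg_eq_add, ite_self, mul_one]
    rcases eq_or_ne j 0 with rfl | hj
    · simp only [if_true, AddMonoidAlgebra.coeff_zero, Finsupp.zero_apply]
      ring
    · simp only [hj, if_false]
      ring

/-- The generating function of the half-plane walks ending at height `j` is `F cʲ`. -/
theorem halfPlaneWeight_eq_coeff {A : Type*} [CommRing A] (a : A)
    {c F : (LaurentPolynomial A)⟦X⟧} (hc0 : constantCoeff c = 0)
    (hc : c = X * (1 + PowerSeries.C (LaurentPolynomial.T 1 + LaurentPolynomial.T (-1)) * c +
      c ^ 2))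
    (hF : (1 - PowerSeries.C (LaurentPolynomial.C a) * X *
      (PowerSeries.C (LaurentPolynomial.T 1 + LaurentPolynomial.T (-1)) + c)) * F = 1) (n j : ℕ) :
    halfPlaneWeight a n j = coeff n (F * c ^ j) := by
  have hF' : F = 1 + X * (PowerSeries.C (LaurentPolynomial.C a) *
      (PowerSeries.C (LaurentPolynomial.T 1 + LaurentPolynomial.T (-1)) * F + F * c)) := by
    linear_combination hF
  have hF0 : constantCoeff F = 1 := by
    rw [hF']
    simp
  induction n generalizing j with
  | zero => rcases j with _ | j <;> simp [halfPlaneWeight, hc0, hF0]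
  | succ n ih =>
    rcases j with _ | j
    · rw [halfPlaneWeight, ih, ih, pow_zero, mul_one, zero_add, pow_one]
      conv_rhs => rw [hF']
      rw [map_add, coeff_succ_X_mul, coeff_C_mul, map_add, coeff_C_mul, coeff_one]
      simp
    · have h : F * c ^ (j + 1) =
          X * (PowerSeries.C (LaurentPolynomial.T 1 + LaurentPolynomial.T (-1)) *
            (F * c ^ (j + 1)) + F * c ^ (j + 1 + 1) + F * c ^ j) := by
        linear_combination F * c ^ j * hc
      rw [halfPlaneWeight, ih, ih]
      conv_rhs => rw [h]
      rw [coeff_succ_X_mul, map_add, map_add, coeff_C_mul]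
      simp [ih]

/-- The interacting generating function of the simple walk with weights on the horizontal axis
only is D-finite. -/
theorem isDFinite_loopGF_simple {A : Type*} [CommRing A] [IsDomain A] [CharZero A] (a : A)
    (ha0 : a ≠ 0) (ha1 : a ≠ 1) :
    IsDFinite (loopGF ({((1:ℤ), (0:ℤ)), (-1, 0), (0, 1), (0, -1)} : Set (ℤ × ℤ)) a 1) := by
  obtain ⟨c, hc0, hc⟩ := exists_excursionSeries
    (LaurentPolynomial.T 1 + LaurentPolynomial.T (-1) : LaurentPolynomial A)
  have hunit : IsUnit (1 - PowerSeries.C (LaurentPolynomial.C a) * X *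
      (PowerSeries.C (LaurentPolynomial.T 1 + LaurentPolynomial.T (-1)) + c)) := by
    rw [PowerSeries.isUnit_iff_constantCoeff]
    simp
  obtain ⟨F, hF⟩ := hunit.exists_right_inv
  have hG : loopGF ({((1:ℤ), (0:ℤ)), (-1, 0), (0, 1), (0, -1)} : Set (ℤ × ℤ)) a 1 =
      laurentCoeff (-1) ((PowerSeries.C (LaurentPolynomial.T (-1)) -
        PowerSeries.C (LaurentPolynomial.T 1)) * F) := by
    ext1 n
    have h := halfPlaneWeight_eq_coeff a hc0 hc hF n 0
    rw [pow_zero, mul_one] at h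
    rw [coeff_loopGF_simple, simpleWalkWeight_eq_coeff_halfPlaneWeight, coeff_laurentCoeff, sub_mul,
      map_sub (coeff n), coeff_C_mul, coeff_C_mul, ← h, AddMonoidAlgebra.coeff_sub, Finsupp.sub_apply,
      coeff_T_mul, coeff_T_mul]
    norm_num
  set α : (LaurentPolynomial A)⟦X⟧ := PowerSeries.C (LaurentPolynomial.C a) with hα
  set y : (LaurentPolynomial A)⟦X⟧ := PowerSeries.C (LaurentPolynomial.T 1) with hy
  set z : (LaurentPolynomial A)⟦X⟧ := PowerSeries.C (LaurentPolynomial.T (-1)) with hz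
  rw [map_add, ← hy, ← hz] at hc hF
  have hcoeff : ∀ f : (LaurentPolynomial A)⟦X⟧, constantCoeff f ≠ 0 → f ≠ 0 := by
    rintro _ h rfl
    exact h (map_zero _)
  have hC : ∀ r : A, r ≠ 0 → (LaurentPolynomial.C r : LaurentPolynomial A) ≠ 0 := by
    intro r hr h
    apply hr
    have h' := congrArg (fun f => f.coeff 0) h
    simpa using h'
  have hXmem := Algebra.subset_adjoin (R := A) (s := {X, y, z}) (Set.mem_insert X _)
  have hymem := Algebra.subset_adjoin (R := A) (s := {X, y, z}) (Set.mem_insert_of_mem X (.inl rfl))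
  have hzmem := Algebra.subset_adjoin (R := A) (s := {X, y, z}) (Set.mem_insert_of_mem X (.inr rfl))
  have hαmem : α ∈ Algebra.adjoin A {X, y, z} := by
    rw [hα, LaurentPolynomial.C_eq_algebraMap, ← PowerSeries.algebraMap_apply]
    exact Subalgebra.algebraMap_mem _ a
  have humem := mul_mem (mul_mem hαmem hXmem) (add_mem hymem hzmem)
  rw [hG]
  refine isDFinite_laurentCoeff_of_quadratic (F := F)
    (p := (1 - α * X * (y + z)) * (1 - α) + α ^ 2 * X ^ 2) (q := -(2 - α - α * X * (y + z)))
    (r := 1) rfl ?_ ?_ (one_mem _) (sub_mem hzmem hymem) ?_ ?_ ?_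
  · exact add_mem (mul_mem (sub_mem (one_mem _) humem) (sub_mem (one_mem _) hαmem))
      (mul_mem (pow_mem hαmem 2) (pow_mem hXmem 2))
  · exact neg_mem (sub_mem (sub_mem (ofNat_mem _ 2) hαmem) humem)
  · apply hcoeff
    have h := hC (1 - a) (sub_ne_zero.mpr ha1.symm)
    simpa [hα] using h
  · apply hcoeff
    have h := pow_ne_zero 2 (hC a ha0)
    have h2 : constantCoeff (2 : (LaurentPolynomial A)⟦X⟧) = 2 := map_ofNat _ 2
    have h4 : constantCoeff (4 : (LaurentPolynomial A)⟦X⟧) = 4 := map_ofNat _ 4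
    simp only [hα, map_sub, map_add, map_mul, map_pow, map_neg, map_one, constantCoeff_X,
      constantCoeff_C, h2, h4]
    convert h using 1
    ring
  · linear_combination ((1 - α * X * (y + z)) * F - 1 + α * X * c * F -
      α * F * (1 - X * (y + z))) * hF - α ^ 2 * F ^ 2 * X * hc

theorem loopGF_simple_comm {A : Type*} [CommRing A] (a b : A) :
    loopGF ({((1:ℤ), (0:ℤ)), (-1, 0), (0, 1), (0, -1)} : Set (ℤ × ℤ)) a b =
      loopGF ({((1:ℤ), (0:ℤ)), (-1, 0), (0, 1), (0, -1)} : Set (ℤ × ℤ)) b a := by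
  ext1 n
  rw [coeff_loopGF_simple, coeff_loopGF_simple, simpleWalkWeight_comm]

/-- Model 1 (the simple walk): `G(t;a,1)` and `G(t;1,b)` are D-finite. -/
theorem model1_Ga1_G1b_dfinite :
    IsDFinite (loopGF ({((1:ℤ), (0:ℤ)), (-1, 0), (0, 1), (0, -1)} : Set (ℤ × ℤ)) (Polynomial.X : Polynomial ℚ) 1) ∧
    IsDFinite (loopGF ({((1:ℤ), (0:ℤ)), (-1, 0), (0, 1), (0, -1)} : Set (ℤ × ℤ)) (1 : Polynomial ℚ) Polynomial.X) := by
  rw [loopGF_simple_comm 1]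
  have h := isDFinite_loopGF_simple (Polynomial.X : Polynomial ℚ) Polynomial.X_ne_zero
    (fun h => by simpa using congrArg Polynomial.natDegree h)
  exact ⟨h, h⟩
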